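/- Let f ∈ Diff¹_ω(D). If there exists a sequence (q_k) of positive integers such that d₀(f^{q_k}, id) → 0 as k → ∞ (the iterates f^{q_k} converge to the identity in the C⁰ topology), then Cal₁(f) = 0. -/

import Mathlib

open MeasureTheory Metric Set Filter Topology
open scoped Real

noncomputable section

/-- The closed unit disk in `ℂ ≅ ℝ²`. -/
def Disk : Set ℂ := Metric.closedBall 0 1

/-- The unit circle, boundary of the closed unit disk. -/
def Circ : Set ℂ := Metric.sphere 0 1

/-- The standard Liouville form `λ_z(w) = (z₁ w₂ - z₂ w₁)/(2π)`, whose exterior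
derivative is the normalized area form `ω = (1/π) du ∧ dv`. -/
def lform (z w : ℂ) : ℝ := (z.re * w.im - z.im * w.re) / (2 * Real.pi)

/-- An element of `Diff¹_ω(D)`: a `C¹` diffeomorphism of the closed unit disk onto itself
whose Jacobian determinant equals `1` at every point. -/
structure SympDiff where
  toFun : ℂ → ℂ
  invFun : ℂ → ℂ
  mapsTo : Set.MapsTo toFun Disk Disk
  inv_mapsTo : Set.MapsTo invFun Disk Disk
  left_inv : ∀ z ∈ Disk, invFun (toFun z) = z
  right_inv : ∀ z ∈ Disk, toFun (invFun z) = z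
  contDiffOn : ContDiffOn ℝ 1 toFun Disk
  inv_contDiffOn : ContDiffOn ℝ 1 invFun Disk
  jacobian : ∀ z ∈ Disk,
    LinearMap.det (fderivWithin ℝ toFun Disk z).toLinearMap = 1

/-- `A` is an action function of `f`: a `C¹` function with `dA = f*λ - λ` on the disk. -/
def IsAction (f : SympDiff) (A : ℂ → ℝ) : Prop :=
  ContDiffOn ℝ 1 A Disk ∧
    ∀ z ∈ Disk, ∀ w : ℂ,
      fderivWithin ℝ A Disk z w =
        lform (f.toFun z) (fderivWithin ℝ f.toFun Disk z w) - lform z w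

/-- `μ` is a Borel probability measure concentrated on the unit circle and invariant
under `f|_{S¹}`. -/
def IsInvariantCircleMeasure (f : SympDiff) (μ : Measure ℂ) : Prop :=
  IsProbabilityMeasure μ ∧ μ Circᶜ = 0 ∧ Measure.map f.toFun μ = μ

/-- `A` is a normalized action function of `f`: an action function whose integral over the
circle with respect to some `f|_{S¹}`-invariant probability measure vanishes. -/
def IsNormalizedAction (f : SympDiff) (A : ℂ → ℝ) : Prop :=
  IsAction f A ∧
    ∃ μ : Measure ℂ, IsInvariantCircleMeasure f μ ∧ ∫ z, A z ∂μ = 0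

/-- The `C⁰` distance between two disk diffeomorphisms (given with their inverses). -/
def d0 (f fi g gi : ℂ → ℂ) : ℝ :=
  max (⨆ z : Disk, ‖f (z : ℂ) - g (z : ℂ)‖) (⨆ z : Disk, ‖fi (z : ℂ) - gi (z : ℂ)‖)

/-- The `C¹` distance between two disk diffeomorphisms (given with their inverses). -/
def d1 (f fi g gi : ℂ → ℂ) : ℝ :=
  max (d0 f fi g gi)
    (max (⨆ z : Disk, ‖fderivWithin ℝ f Disk (z : ℂ) - fderivWithin ℝ g Disk (z : ℂ)‖)
      (⨆ z : Disk, ‖fderivWithin ℝ fi Disk (z : ℂ) - fderivWithin ℝ gi Disk (z : ℂ)‖))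

theorem Complex.integral_eq_integral_circleAverage {f : ℂ → ℂ} (hm : Measurable f)
    (hf : Integrable f) :
    ∫ z, f z = ∫ r in Ioi (0 : ℝ), r • (2 * π) • Real.circleAverage f 0 r := by
  have hms : Measurable fun p : ℝ × ℝ => Complex.polarCoord.symm p := by
    simp only [Complex.polarCoord_symm_apply]
    fun_prop
  have hint : IntegrableOn (fun p : ℝ × ℝ => p.1 • f (Complex.polarCoord.symm p))
      (Ioi (0 : ℝ) ×ˢ Ioo (-π) π) := by
    refine ⟨(measurable_fst.smul (hm.comp hms)).aestronglyMeasurable, ?_⟩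
    have h := Complex.lintegral_comp_polarCoord_symm (fun z => ‖f z‖ₑ)
    rw [polarCoord_target] at h
    rw [HasFiniteIntegral]
    refine lt_of_le_of_lt (le_of_eq ?_) (h.trans_lt hf.2)
    refine setLIntegral_congr_fun (measurableSet_Ioi.prod measurableSet_Ioo) fun p hp => ?_
    simp only [enorm_smul, smul_eq_mul]
    rw [Real.enorm_eq_ofReal (le_of_lt hp.1)]
  rw [← Complex.integral_comp_polarCoord_symm, polarCoord_target]
  rw [Measure.volume_eq_prod, setIntegral_prod _ hint]
  refine setIntegral_congr_fun measurableSet_Ioi fun r hr => ?_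
  simp only [integral_smul]
  congr 1
  rw [Real.circleAverage_eq_integral_add (-π), smul_smul, mul_inv_cancel₀ (by positivity), one_smul,
    intervalIntegral.integral_comp_add_right (fun θ ↦ f (circleMap 0 r θ)),
    intervalIntegral.integral_of_le (by linarith [Real.pi_pos]), integral_Ioc_eq_integral_Ioo]
  have e1 : 0 + -π = -π := by ring
  have e2 : 2 * π + -π = π := by ring
  rw [e1, e2]
  refine setIntegral_congr_fun measurableSet_Ioo fun θ _ => ?_
  simp [circleMap, Complex.exp_mul_I]

theorem integrableOn_inv_norm_ball (R : ℝ) :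
    IntegrableOn (fun z : ℂ => ‖z‖⁻¹) (ball 0 R) := by
  refine (integrableOn_fun_norm_addHaar (volume : Measure ℂ) (f := fun r => r⁻¹) (r := R)).2 ?_
  have : IntegrableOn (fun _ : ℝ => (1 : ℝ)) (Ioo 0 R) := by simp
  refine this.congr_fun (fun r hr => ?_) measurableSet_Ioo
  simp [Complex.finrank_real_complex, hr.1.ne']

theorem measurableSet_disk : MeasurableSet Disk := isClosed_closedBall.measurableSet

theorem mem_disk {z : ℂ} : z ∈ Disk ↔ ‖z‖ ≤ 1 := by simp [Disk]

/-- A uniform bound for `∫_D ‖x - y‖⁻¹ dy`. -/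
def kernelBound : ℝ := ∫ z in ball (0 : ℂ) 3, ‖z‖⁻¹

theorem integrableOn_inv_norm_sub {x : ℂ} (hx : x ∈ Disk) :
    IntegrableOn (fun y : ℂ => ‖x - y‖⁻¹) Disk ∧ ∫ y in Disk, ‖x - y‖⁻¹ ≤ kernelBound := by
  have hI : Integrable ((ball (0 : ℂ) 3).indicator fun z => ‖z‖⁻¹) :=
    (integrable_indicator_iff measurableSet_ball).2 (integrableOn_inv_norm_ball 3)
  have hI' := hI.comp_sub_left x
  have heq : EqOn (fun y => (ball (0 : ℂ) 3).indicator (fun z => ‖z‖⁻¹) (x - y))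
      (fun y : ℂ => ‖x - y‖⁻¹) Disk := fun y hy => by
    have : x - y ∈ ball (0 : ℂ) 3 := by
      rw [mem_ball_zero_iff]
      linarith [norm_sub_le x y, mem_disk.1 hx, mem_disk.1 hy]
    simp [indicator_of_mem this]
  refine ⟨hI'.integrableOn.congr_fun heq measurableSet_disk, ?_⟩
  rw [← setIntegral_congr_fun measurableSet_disk heq, kernelBound,
    ← integral_indicator measurableSet_ball,
    ← integral_sub_left_eq_self (fun z => (ball (0 : ℂ) 3).indicator (fun z => ‖z‖⁻¹) z) volume x]
  refine setIntegral_le_integral hI' (ae_of_all _ fun y => ?_)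
  exact indicator_nonneg (fun z _ => by positivity) _

theorem integrableOn_inv_sub {x : ℂ} (hx : x ∈ Disk) :
    IntegrableOn (fun y : ℂ => (x - y)⁻¹) Disk := by
  refine (integrableOn_inv_norm_sub hx).1.mono' (by fun_prop) (ae_of_all _ fun y => ?_)
  simp

theorem circleAverage_inv_sub_of_lt {x : ℂ} {r : ℝ} (hr : 0 < r) (h : r < ‖x‖) :
    Real.circleAverage (fun z => (x - z)⁻¹) 0 r = x⁻¹ := by
  have hd : DifferentiableOn ℂ (fun z => (x - z)⁻¹) (closedBall 0 |r|) := fun z hz => by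
    have : x - z ≠ 0 := fun h0 => by
      rw [mem_closedBall_zero_iff, abs_of_pos hr, ← sub_eq_zero.1 h0] at hz
      linarith
    exact ((differentiableAt_id.const_sub x).inv this).differentiableWithinAt
  rw [(hd.diffContOnCl_ball le_rfl).circleAverage]
  simp

theorem circleAverage_inv_sub_of_gt {x : ℂ} (hx : x ≠ 0) {r : ℝ} (hr : 0 < r) (h : ‖x‖ < r) :
    Real.circleAverage (fun z => (x - z)⁻¹) 0 r = 0 := by
  have hw : x ∈ ball (0 : ℂ) |r| := by simpa [abs_of_pos hr] using h
  have h1 : Real.circleAverage (fun z : ℂ => ((z - 0) / (z - x)) • (1 : ℂ)) 0 r = 1 :=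
    (diffContOnCl_const (c := (1 : ℂ))).circleAverage_smul_div hw
  have hne : ∀ z ∈ sphere (0 : ℂ) |r|, z - x ≠ 0 := fun z hz h0 => by
    rw [mem_sphere_zero_iff_norm, abs_of_pos hr, sub_eq_zero.1 h0] at hz
    linarith
  have hc : CircleIntegrable (fun z : ℂ => ((z - 0) / (z - x)) • (1 : ℂ)) 0 r := by
    refine ContinuousOn.circleIntegrable' fun z hz => ?_
    have := hne z hz
    exact ContinuousAt.continuousWithinAt (by fun_prop (disch := assumption))
  have h2 : Real.circleAverage (fun z => (x - z)⁻¹) 0 r =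
      Real.circleAverage (fun z => (-x⁻¹) • (((z - 0) / (z - x)) • (1 : ℂ) - 1)) 0 r := by
    refine Real.circleAverage_congr_sphere fun z hz => ?_
    have h3 := hne z hz
    have h4 : x - z ≠ 0 := fun h => h3 (by linear_combination -h)
    simp only [smul_eq_mul, mul_one, sub_zero]
    field_simp
    ring
  rw [h2, Real.circleAverage_fun_smul, Real.circleAverage_fun_sub hc (by fun_prop), h1,
    Real.circleAverage_const]
  simp

/-- The Cauchy transform of the closed unit disk. -/
theorem integral_disk_inv_sub {x : ℂ} (hx : x ∈ Disk) :
    ∫ y in Disk, (x - y)⁻¹ = π * (starRingEnd ℂ) x := by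
  rcases eq_or_ne x 0 with rfl | hx0
  · have h := integral_neg_eq_self (Disk.indicator fun y : ℂ => (0 - y)⁻¹) volume
    have h' : ∀ y : ℂ, Disk.indicator (fun y : ℂ => (0 - y)⁻¹) (-y) =
        - Disk.indicator (fun y : ℂ => (0 - y)⁻¹) y := fun y => by
      by_cases hy : y ∈ Disk
      · rw [indicator_of_mem hy, indicator_of_mem (by simpa [mem_disk] using hy)]
        simp [inv_neg]
      · rw [indicator_of_notMem hy, indicator_of_notMem (by simpa [mem_disk] using hy)]
        simp
    simp only [h', integral_neg] at h
    rw [integral_indicator measurableSet_disk] at h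
    rw [self_eq_neg.1 h.symm]
    simp
  have hm : Measurable (Disk.indicator fun y : ℂ => (x - y)⁻¹) :=
    (by fun_prop : Measurable fun y : ℂ => (x - y)⁻¹).indicator measurableSet_disk
  rw [← integral_indicator measurableSet_disk, Complex.integral_eq_integral_circleAverage hm
    ((integrable_indicator_iff measurableSet_disk).2 (integrableOn_inv_sub hx))]
  have hpos : 0 < ‖x‖ := norm_pos_iff.2 hx0
  have hx1 := mem_disk.1 hx
  have key : ∀ r : ℝ, r ≠ ‖x‖ → r ∈ Ioi (0 : ℝ) → r • (2 * π) • Real.circleAverage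
      (Disk.indicator fun y : ℂ => (x - y)⁻¹) 0 r =
      (Ioo 0 ‖x‖).indicator (fun r : ℝ => (r : ℂ) * (2 * π * x⁻¹)) r := by
    intro r hne (hr : 0 < r)
    rcases le_or_gt r 1 with h1 | h1
    · have : Real.circleAverage (Disk.indicator fun y : ℂ => (x - y)⁻¹) 0 r =
          Real.circleAverage (fun y : ℂ => (x - y)⁻¹) 0 r := by
        refine Real.circleAverage_congr_sphere fun z hz => ?_
        rw [mem_sphere_zero_iff_norm, abs_of_pos hr] at hz
        exact indicator_of_mem (mem_disk.2 (hz.trans_le h1)) _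
      rw [this]
      rcases lt_or_gt_of_ne hne with h | h
      · rw [circleAverage_inv_sub_of_lt hr h, indicator_of_mem (by exact ⟨hr, h⟩)]
        simp [Complex.real_smul]
      · rw [circleAverage_inv_sub_of_gt hx0 hr h, indicator_of_notMem (fun h' => h.not_gt h'.2)]
        simp
    · have : Real.circleAverage (Disk.indicator fun y : ℂ => (x - y)⁻¹) 0 r =
          Real.circleAverage (fun _ : ℂ => (0 : ℂ)) 0 r := by
        refine Real.circleAverage_congr_sphere fun z hz => ?_
        rw [mem_sphere_zero_iff_norm, abs_of_pos hr] at hz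
        exact indicator_of_notMem (fun h => by linarith [mem_disk.1 h]) _
      rw [this, Real.circleAverage_const,
        indicator_of_notMem (fun h' => by linarith [h'.2])]
      simp
  have hae : ∀ᵐ r : ℝ, r ≠ ‖x‖ := by simp [ae_iff]
  rw [setIntegral_congr_ae measurableSet_Ioi (hae.mono key),
    setIntegral_indicator measurableSet_Ioo,
    inter_eq_right.2 Ioo_subset_Ioi_self, integral_mul_const, integral_complex_ofReal,
    ← integral_Ioc_eq_integral_Ioo, ← intervalIntegral.integral_of_le hpos.le, integral_id]
  have h5 : ((‖x‖ : ℂ)) ^ 2 = (starRingEnd ℂ) x * x := by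
    rw [mul_comm, Complex.mul_conj, Complex.normSq_eq_norm_sq]
    push_cast; rfl
  push_cast
  rw [h5]
  field_simp
  ring

/-- The radial retraction of the plane onto the closed unit disk. -/
def diskRetraction (z : ℂ) : ℂ := ((max 1 ‖z‖)⁻¹ : ℝ) • z

theorem diskRetraction_of_mem {z : ℂ} (hz : z ∈ Disk) : diskRetraction z = z := by
  simp [diskRetraction, max_eq_left (mem_disk.1 hz)]

theorem diskRetraction_mem (z : ℂ) : diskRetraction z ∈ Disk := by
  have h : 0 < max 1 ‖z‖ := lt_max_of_lt_left one_pos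
  rw [mem_disk, diskRetraction, norm_smul, Real.norm_of_nonneg (inv_nonneg.2 h.le),
    inv_mul_le_iff₀ h, mul_one]
  exact le_max_right _ _

@[fun_prop]
theorem continuous_diskRetraction : Continuous diskRetraction := by
  unfold diskRetraction
  have h : ∀ z : ℂ, max 1 ‖z‖ ≠ 0 := fun z => (lt_max_of_lt_left one_pos).ne'
  fun_prop (disch := exact h _)

theorem convex_disk : Convex ℝ Disk := convex_closedBall 0 1

theorem isCompact_disk : IsCompact Disk := isCompact_closedBall 0 1

theorem uniqueDiffOn_disk : UniqueDiffOn ℝ Disk :=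
  uniqueDiffOn_convex convex_disk ⟨0, by simp [Disk, interior_closedBall]⟩

namespace SympDiff

variable (f : SympDiff)

/-- A continuous extension of `f` to the whole plane, with values in the disk. -/
def extend (z : ℂ) : ℂ := f.toFun (diskRetraction z)

theorem extend_of_mem {z : ℂ} (hz : z ∈ Disk) : f.extend z = f.toFun z := by
  rw [extend, diskRetraction_of_mem hz]

theorem extend_mem (z : ℂ) : f.extend z ∈ Disk := f.mapsTo (diskRetraction_mem z)

@[fun_prop]
theorem continuous_extend : Continuous f.extend :=
  f.contDiffOn.continuousOn.comp_continuous continuous_diskRetraction diskRetraction_mem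

theorem injOn_extend : InjOn f.extend Disk := fun x hx y hy h => by
  rw [f.extend_of_mem hx, f.extend_of_mem hy] at h
  rw [← f.left_inv x hx, h, f.left_inv y hy]

theorem extend_iterate_mem (n : ℕ) {z : ℂ} (hz : z ∈ Disk) : f.extend^[n] z ∈ Disk :=
  MapsTo.iterate (fun z _ => f.extend_mem z) n hz

theorem extend_iterate_of_mem (n : ℕ) {z : ℂ} (hz : z ∈ Disk) :
    f.extend^[n] z = f.toFun^[n] z := by
  induction n with
  | zero => rfl
  | succ n ih =>
    rw [Function.iterate_succ_apply', Function.iterate_succ_apply', ← ih,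
      f.extend_of_mem (f.extend_iterate_mem n hz)]

/-- The derivative of `f` within the disk. -/
def deriv (z : ℂ) : ℂ →L[ℝ] ℂ := fderivWithin ℝ f.toFun Disk z

theorem hasFDerivWithinAt {z : ℂ} (hz : z ∈ Disk) :
    HasFDerivWithinAt f.extend (f.deriv z) Disk z :=
  ((f.contDiffOn.differentiableOn one_ne_zero z hz).hasFDerivWithinAt).congr
    (fun _ h => f.extend_of_mem h) (f.extend_of_mem hz)

theorem continuousOn_deriv : ContinuousOn f.deriv Disk :=
  f.contDiffOn.continuousOn_fderivWithin uniqueDiffOn_disk le_rfl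

theorem image_extend : f.extend '' Disk = Disk := by
  refine Subset.antisymm (image_subset_iff.2 fun z _ => f.extend_mem z) fun z hz => ?_
  exact ⟨f.invFun z, f.inv_mapsTo hz,
    by rw [f.extend_of_mem (f.inv_mapsTo hz), f.right_inv z hz]⟩

theorem measurePreserving_extend :
    MeasurePreserving f.extend (volume.restrict Disk) (volume.restrict Disk) := by
  refine ⟨f.continuous_extend.measurable, ?_⟩
  have h := map_withDensity_abs_det_fderiv_eq_addHaar volume measurableSet_disk.nullMeasurableSet
    (fun z hz => f.hasFDerivWithinAt hz) f.injOn_extend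
  rw [image_extend] at h
  conv_rhs => rw [← h]
  congr 1
  have h1 : (fun z => ENNReal.ofReal |(f.deriv z).det|) =ᵐ[volume.restrict Disk] 1 := by
    filter_upwards [ae_restrict_mem measurableSet_disk] with z hz
    have : (f.deriv z).det = 1 := f.jacobian z hz
    simp [this]
  rw [withDensity_congr_ae h1, withDensity_one]

theorem measurePreserving_extend_of_invariant {μ : Measure ℂ}
    (hμ : IsInvariantCircleMeasure f μ) : MeasurePreserving f.extend μ μ := by
  refine ⟨f.continuous_extend.measurable, ?_⟩
  have h : ∀ᵐ z ∂μ, z ∈ Circ := by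
    rw [ae_iff]; exact hμ.2.1
  conv_rhs => rw [← hμ.2.2]
  refine Measure.map_congr (h.mono fun z hz => f.extend_of_mem ?_)
  exact sphere_subset_closedBall hz

end SympDiff

/-- `θ` is a determination of the argument of the nonzero complex number `z`. -/
def IsAngle (z : ℂ) (θ : ℝ) : Prop := ∃ r : ℝ, 0 < r ∧ z = r * Complex.exp (θ * Complex.I)

namespace IsAngle

theorem arg {z : ℂ} (hz : z ≠ 0) : IsAngle z z.arg :=
  ⟨‖z‖, norm_pos_iff.2 hz, (Complex.norm_mul_exp_arg_mul_I z).symm⟩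

theorem one : IsAngle 1 0 := ⟨1, one_pos, by simp⟩

theorem mul {z w : ℂ} {θ φ : ℝ} (hz : IsAngle z θ) (hw : IsAngle w φ) :
    IsAngle (z * w) (θ + φ) := by
  obtain ⟨r, hr, rfl⟩ := hz
  obtain ⟨s, hs, rfl⟩ := hw
  refine ⟨r * s, mul_pos hr hs, ?_⟩
  push_cast
  rw [add_mul, Complex.exp_add]
  ring

theorem inv {z : ℂ} {θ : ℝ} (hz : IsAngle z θ) : IsAngle z⁻¹ (-θ) := by
  obtain ⟨r, hr, rfl⟩ := hz
  refine ⟨r⁻¹, inv_pos.2 hr, ?_⟩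
  push_cast
  rw [neg_mul, Complex.exp_neg, mul_inv]

theorem ne_zero {z : ℂ} {θ : ℝ} (hz : IsAngle z θ) : z ≠ 0 := by
  obtain ⟨r, hr, rfl⟩ := hz
  exact mul_ne_zero (by exact_mod_cast hr.ne') (Complex.exp_ne_zero _)

theorem pos_mul {z : ℂ} {θ s : ℝ} (hz : IsAngle z θ) (hs : 0 < s) : IsAngle (s * z) θ := by
  obtain ⟨r, hr, rfl⟩ := hz
  exact ⟨s * r, mul_pos hs hr, by push_cast; ring⟩

theorem sub_eq_two_pi_mul_int {z : ℂ} {θ φ : ℝ} (hθ : IsAngle z θ) (hφ : IsAngle z φ) :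
    ∃ n : ℤ, θ - φ = n * (2 * π) := by
  obtain ⟨r, hr, h⟩ := hθ.mul hφ.inv
  rw [mul_inv_cancel₀ hφ.ne_zero] at h
  have hr1 : r = 1 := by
    have := congrArg norm h
    rw [norm_mul, Complex.norm_exp_ofReal_mul_I, Complex.norm_real, norm_one, mul_one,
      Real.norm_of_nonneg hr.le] at this
    exact this.symm
  rw [hr1, Complex.ofReal_one, one_mul, eq_comm, Complex.exp_eq_one_iff] at h
  obtain ⟨n, hn⟩ := h
  refine ⟨n, ?_⟩
  have h2 : ((θ + -φ : ℝ) : ℂ) = n * (2 * π) :=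
    mul_right_cancel₀ Complex.I_ne_zero (by rw [hn]; ring)
  rw [sub_eq_add_neg]
  exact_mod_cast h2

theorem sub_eq_arg_div {z w : ℂ} {θ φ : ℝ} (hz : IsAngle z θ) (hw : IsAngle w φ)
    (h : |θ - φ| < π) : θ - φ = (z / w).arg := by
  obtain ⟨r, hr, hzw⟩ := hz.mul hw.inv
  rw [div_eq_mul_inv, hzw, Complex.exp_mul_I, ← sub_eq_add_neg,
    Complex.arg_mul_cos_add_sin_mul_I hr ⟨(abs_lt.1 h).1, (abs_lt.1 h).2.le⟩]

end IsAngle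

theorem exists_continuous_angle {F : ℂ × ℂ → ℂ} (hF : Continuous F) (h0 : ∀ p, F p ≠ 0) :
    ∃ L : ℂ × ℂ → ℝ, Continuous L ∧ ∀ p, IsAngle (F p) (L p) := by
  have hmem : ∀ p, F p / ‖F p‖ ∈ Submonoid.unitSphere ℂ := fun p => by
    have := norm_ne_zero_iff.2 (h0 p)
    exact mem_sphere_zero_iff_norm.2 (by simp [this])
  let u : C(ℂ × ℂ, Circle) := ⟨fun p => ⟨F p / ‖F p‖, hmem p⟩,
    Continuous.subtype_mk (hF.div (by fun_prop) fun p => by simpa using h0 p) _⟩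
  obtain ⟨e, he⟩ := Circle.exp_surjective (u 0)
  obtain ⟨L, ⟨-, hL⟩, -⟩ := Circle.isCoveringMap_exp.existsUnique_continuousMap_lifts u 0 e he
  refine ⟨L, L.continuous, fun p => ⟨‖F p‖, norm_pos_iff.2 (h0 p), ?_⟩⟩
  have h := congrArg (fun c : Circle => (c : ℂ)) (congrFun hL p)
  have hn : (‖F p‖ : ℂ) ≠ 0 := by simpa using h0 p
  simp only [Function.comp_apply, Circle.coe_exp] at h
  rw [h]
  change F p = ‖F p‖ * (F p / ‖F p‖)
  field_simp

/-- The complex linear part of a real linear endomorphism of `ℂ`. -/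
def linPart (L : ℂ →L[ℝ] ℂ) : ℂ := (L 1 - Complex.I * L Complex.I) / 2

/-- The antilinear part of a real linear endomorphism of `ℂ`. -/
def antilinPart (L : ℂ →L[ℝ] ℂ) : ℂ := (L 1 + Complex.I * L Complex.I) / 2

theorem apply_eq_linPart_add_antilinPart (L : ℂ →L[ℝ] ℂ) (w : ℂ) :
    L w = linPart L * w + antilinPart L * (starRingEnd ℂ) w := by
  have h : L w = w.re * L 1 + w.im * L Complex.I := by
    conv_lhs => rw [← Complex.re_add_im w, ← mul_one (w.re : ℂ), ← Complex.real_smul,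
      ← Complex.real_smul, map_add, map_smul, map_smul]
    simp
  have h1 := Complex.re_add_im w
  have h2 : (starRingEnd ℂ) w = w.re - w.im * Complex.I := by
    apply Complex.ext <;> simp
  rw [h, h2, linPart, antilinPart]
  nth_rw 3 [← h1]
  linear_combination (w.im * L Complex.I) * Complex.I_mul_I

theorem det_eq_normSq_sub (L : ℂ →L[ℝ] ℂ) :
    LinearMap.det L.toLinearMap = ‖linPart L‖ ^ 2 - ‖antilinPart L‖ ^ 2 := by
  rw [← LinearMap.det_toMatrix Complex.basisOneI, Matrix.det_fin_two]
  simp only [LinearMap.toMatrix_apply, Complex.coe_basisOneI, Complex.coe_basisOneI_repr]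
  rw [← Complex.normSq_eq_norm_sq, ← Complex.normSq_eq_norm_sq, linPart, antilinPart]
  simp [Complex.normSq_apply]
  ring

theorem norm_linPart_le (L : ℂ →L[ℝ] ℂ) : ‖linPart L‖ ≤ ‖L‖ := by
  have h1 : ‖L 1‖ ≤ ‖L‖ := by simpa using L.le_opNorm 1
  have h2 : ‖L Complex.I‖ ≤ ‖L‖ := by simpa using L.le_opNorm Complex.I
  rw [linPart, norm_div, Complex.norm_two, div_le_iff₀ two_pos]
  refine (norm_sub_le _ _).trans ?_
  rw [norm_mul, Complex.norm_I, one_mul]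
  linarith

theorem norm_antilinPart_le (L : ℂ →L[ℝ] ℂ) : ‖antilinPart L‖ ≤ ‖L‖ := by
  have h1 : ‖L 1‖ ≤ ‖L‖ := by simpa using L.le_opNorm 1
  have h2 : ‖L Complex.I‖ ≤ ‖L‖ := by simpa using L.le_opNorm Complex.I
  rw [antilinPart, norm_div, Complex.norm_two, div_le_iff₀ two_pos]
  refine (norm_add_le _ _).trans ?_
  rw [norm_mul, Complex.norm_I, one_mul]
  linarith

theorem re_mul_conj_linPart_pos {L : ℂ →L[ℝ] ℂ} (hL : LinearMap.det L.toLinearMap = 1)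
    {K : ℝ} (hK : ‖L‖ ≤ K) (hK0 : 0 < K) {v w : ℂ} (hw : w ≠ 0)
    (hv : ‖v - L w‖ ≤ (4 * K)⁻¹ * ‖w‖) :
    0 < (v * (starRingEnd ℂ) w * (starRingEnd ℂ) (linPart L)).re := by
  set a := linPart L
  set b := antilinPart L
  have hdet : 1 = ‖a‖ ^ 2 - ‖b‖ ^ 2 := by rw [← hL, det_eq_normSq_sub]
  have ha := (norm_linPart_le L).trans hK
  have hb := (norm_antilinPart_le L).trans hK
  have ha0 : 0 < ‖a‖ := by
    by_contra h
    have : ‖a‖ = 0 := le_antisymm (not_lt.1 h) (norm_nonneg _)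
    rw [this] at hdet
    nlinarith [sq_nonneg ‖b‖]
  have hw0 := norm_pos_iff.2 hw
  have hab : (2 * K)⁻¹ ≤ ‖a‖ - ‖b‖ := by
    rw [inv_le_iff_one_le_mul₀ (by positivity)]
    have : 0 ≤ ‖a‖ - ‖b‖ := by
      by_contra h
      nlinarith [norm_nonneg b]
    nlinarith
  have hid : v * (starRingEnd ℂ) w * (starRingEnd ℂ) a =
      (‖a‖ ^ 2 * ‖w‖ ^ 2 : ℝ) + (b * (starRingEnd ℂ) w + (v - L w)) * (starRingEnd ℂ) w *
        (starRingEnd ℂ) a := by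
    have h1 : (‖a‖ : ℂ) ^ 2 = a * (starRingEnd ℂ) a := by
      rw [Complex.mul_conj, Complex.normSq_eq_norm_sq]; push_cast; rfl
    have h2 : (‖w‖ : ℂ) ^ 2 = w * (starRingEnd ℂ) w := by
      rw [Complex.mul_conj, Complex.normSq_eq_norm_sq]; push_cast; rfl
    rw [apply_eq_linPart_add_antilinPart L w]
    push_cast
    rw [h1, h2]
    ring
  rw [hid, Complex.add_re, Complex.ofReal_re]
  have hre := (abs_le.1 (Complex.abs_re_le_norm ((b * (starRingEnd ℂ) w + (v - L w)) *
    (starRingEnd ℂ) w * (starRingEnd ℂ) a))).1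
  have hno : ‖(b * (starRingEnd ℂ) w + (v - L w)) * (starRingEnd ℂ) w * (starRingEnd ℂ) a‖ ≤
      (‖b‖ * ‖w‖ + (4 * K)⁻¹ * ‖w‖) * ‖w‖ * ‖a‖ := by
    rw [norm_mul, norm_mul, Complex.norm_conj, Complex.norm_conj]
    gcongr
    refine (norm_add_le _ _).trans ?_
    rw [norm_mul, Complex.norm_conj]
    gcongr
  have h4 : (4 * K)⁻¹ < (2 * K)⁻¹ := by gcongr; norm_num
  have : 0 < ‖w‖ ^ 2 * ‖a‖ * (‖a‖ - ‖b‖ - (4 * K)⁻¹) := by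
    have : 0 < ‖a‖ - ‖b‖ - (4 * K)⁻¹ := by linarith
    positivity
  nlinarith

namespace SympDiff

variable (f : SympDiff)

theorem exists_norm_deriv_le : ∃ K, 0 < K ∧ ∀ z ∈ Disk, ‖f.deriv z‖ ≤ K := by
  obtain ⟨K, hK⟩ := isCompact_disk.exists_bound_of_continuousOn f.continuousOn_deriv
  exact ⟨max K 1, lt_max_of_lt_right one_pos, fun z hz => (hK z hz).trans (le_max_left _ _)⟩

theorem exists_re_pos_near_diagonal : ∃ δ > 0, ∀ x ∈ Disk, ∀ y ∈ Disk, x ≠ y → ‖x - y‖ < δ →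
    0 < ((f.extend x - f.extend y) * (starRingEnd ℂ) (x - y) *
      (starRingEnd ℂ) (linPart (f.deriv y))).re := by
  obtain ⟨K, hK0, hK⟩ := f.exists_norm_deriv_le
  have huc := isCompact_disk.uniformContinuousOn_of_continuous f.continuousOn_deriv
  obtain ⟨δ, hδ, hu⟩ := Metric.uniformContinuousOn_iff.1 huc (4 * K)⁻¹ (by positivity)
  refine ⟨δ, hδ, fun x hx y hy hne hxy => ?_⟩
  refine re_mul_conj_linPart_pos (f.jacobian y hy) (hK y hy) hK0 (sub_ne_zero.2 hne) ?_
  refine Convex.norm_image_sub_le_of_norm_hasFDerivWithin_le' (s := Disk ∩ ball y δ)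
    (f' := f.deriv) (fun z hz => (f.hasFDerivWithinAt hz.1).mono inter_subset_left)
    (fun z hz => ?_) (convex_disk.inter (convex_ball y δ)) ⟨hy, mem_ball_self hδ⟩
    ⟨hx, by rwa [mem_ball_iff_norm]⟩
  rw [← dist_eq_norm]
  exact (hu z hz.1 y hy hz.2).le

/-- The regularised chord function whose argument lifts to the whole of `D × D`. -/
theorem exists_regularized_chord : ∃ η : ℝ, 0 < η ∧ ∀ x ∈ Disk, ∀ y ∈ Disk,
    (f.extend x - f.extend y) * (starRingEnd ℂ) (x - y) + η * linPart (f.deriv y) ≠ 0 ∧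
    (x ≠ y → 0 < (((f.extend x - f.extend y) * (starRingEnd ℂ) (x - y)) /
      ((f.extend x - f.extend y) * (starRingEnd ℂ) (x - y) + η * linPart (f.deriv y))).re) := by
  obtain ⟨K, hK0, hK⟩ := f.exists_norm_deriv_le
  obtain ⟨δ, hδ, hd⟩ := f.exists_re_pos_near_diagonal
  set N : ℂ × ℂ → ℂ := fun p => (f.extend p.1 - f.extend p.2) * (starRingEnd ℂ) (p.1 - p.2)
  have hN : Continuous N := by
    have := f.continuous_extend
    simp only [N]
    fun_prop
  have hN0 : ∀ x ∈ Disk, ∀ y ∈ Disk, x ≠ y → N (x, y) ≠ 0 := fun x hx y hy hne =>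
    mul_ne_zero (sub_ne_zero.2 fun h => hne (f.injOn_extend hx hy h))
      ((map_ne_zero _).2 (sub_ne_zero.2 hne))
  obtain ⟨m, hm, hmN⟩ : ∃ m > 0, ∀ x ∈ Disk, ∀ y ∈ Disk, δ ≤ ‖x - y‖ → m ≤ ‖N (x, y)‖ := by
    have hcomp : IsCompact ((Disk ×ˢ Disk) ∩ {p : ℂ × ℂ | δ ≤ ‖p.1 - p.2‖}) :=
      (isCompact_disk.prod isCompact_disk).inter_right (isClosed_le (by fun_prop) (by fun_prop))
    obtain ⟨m, hm, h⟩ := hcomp.exists_forall_le' (f := fun p => ‖N p‖) (a := 0)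
      hN.norm.continuousOn (fun p hp => norm_pos_iff.2 (hN0 p.1 hp.1.1 p.2 hp.1.2 fun h => by
        have := hp.2
        simp only [mem_ofPred_eq, h, sub_self, norm_zero] at this
        linarith))
    exact ⟨m, hm, fun x hx y hy hxy => h (x, y) ⟨⟨hx, hy⟩, hxy⟩⟩
  refine ⟨m / (2 * K), by positivity, fun x hx y hy => ?_⟩
  set η := m / (2 * K) with hη
  have hη0 : 0 < η := by positivity
  set a := linPart (f.deriv y) with ha
  have haK : ‖a‖ ≤ K := (norm_linPart_le _).trans (hK y hy)
  have ha0 : a ≠ 0 := fun h => by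
    have h1 := det_eq_normSq_sub (f.deriv y)
    rw [show LinearMap.det (f.deriv y).toLinearMap = 1 from f.jacobian y hy, ← ha, h, norm_zero]
      at h1
    nlinarith [sq_nonneg ‖antilinPart (f.deriv y)‖]
  change N (x, y) + η * a ≠ 0 ∧ (x ≠ y → 0 < (N (x, y) / (N (x, y) + η * a)).re)
  have hre : x ≠ y → 0 < (N (x, y) * (starRingEnd ℂ) (N (x, y) + η * a)).re := fun hne => by
    have hn := norm_pos_iff.2 (hN0 x hx y hy hne)
    rw [map_add, mul_add, Complex.add_re, Complex.mul_conj, Complex.ofReal_re,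
      Complex.normSq_eq_norm_sq, map_mul, Complex.conj_ofReal, mul_left_comm, Complex.re_ofReal_mul]
    rcases lt_or_ge ‖x - y‖ δ with h | h
    · have := hd x hx y hy hne h
      change 0 < (N (x, y) * (starRingEnd ℂ) a).re at this
      positivity
    · have h1 := (abs_le.1 (Complex.abs_re_le_norm (N (x, y) * (starRingEnd ℂ) a))).1
      rw [norm_mul, Complex.norm_conj] at h1
      have h2 := hmN x hx y hy h
      have h3 : η * ‖a‖ ≤ m / 2 := by
        calc η * ‖a‖ ≤ η * K := by gcongr
          _ = m / 2 := by rw [hη]; field_simp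
      have h4 : η * (N (x, y) * (starRingEnd ℂ) a).re ≥ - (‖N (x, y)‖ * (η * ‖a‖)) := by
        nlinarith
      nlinarith
  constructor
  · rcases eq_or_ne x y with rfl | hne
    · have : N (x, x) = 0 := by simp [N]
      rw [this, zero_add]
      exact mul_ne_zero (by exact_mod_cast hη0.ne') ha0
    · intro h
      have := hre hne
      rw [h] at this
      simp at this
  · intro hne
    have h1 := hre hne
    have h2 : N (x, y) + η * a ≠ 0 := fun h => by
      rw [h] at h1
      simp at h1
    rw [Complex.div_re, ← add_div]
    refine div_pos ?_ (Complex.normSq_pos.2 h2)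
    rw [Complex.mul_re, Complex.conj_re, Complex.conj_im] at h1
    linarith

/-- A bounded choice of argument for the difference quotients of `f`, continuous off the
diagonal. -/
theorem exists_angle : ∃ (θ : ℂ → ℂ → ℝ) (M : ℝ), (∀ x, Measurable (θ x)) ∧
    (∀ x ∈ Disk, ∀ y ∈ Disk, |θ x y| ≤ M) ∧
    (∀ y ∈ Disk, ContinuousOn (fun x => θ x y) (Disk \ {y})) ∧
    ∀ x ∈ Disk, ∀ y ∈ Disk, x ≠ y →
      IsAngle ((f.extend x - f.extend y) / (x - y)) (θ x y) := by
  obtain ⟨η, hη0, hη⟩ := f.exists_regularized_chord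
  let N : ℂ × ℂ → ℂ := fun p => (f.extend p.1 - f.extend p.2) * (starRingEnd ℂ) (p.1 - p.2)
  let F : ℂ × ℂ → ℂ := fun p => N (diskRetraction p.1, diskRetraction p.2) +
    η * linPart (f.deriv (diskRetraction p.2))
  have hN : Continuous N := by
    have := f.continuous_extend
    simp only [N]
    fun_prop
  have hd : Continuous fun z => f.deriv (diskRetraction z) :=
    f.continuousOn_deriv.comp_continuous continuous_diskRetraction diskRetraction_mem
  have hF : Continuous F := by
    have := hd.comp (continuous_snd (X := ℂ) (Y := ℂ))
    simp only [Function.comp_def] at this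
    simp only [F, linPart]
    fun_prop
  obtain ⟨L, hL, hang⟩ := exists_continuous_angle hF fun p =>
    (hη _ (diskRetraction_mem _) _ (diskRetraction_mem _)).1
  have hFd : ∀ x ∈ Disk, ∀ y ∈ Disk, F (x, y) = N (x, y) + η * linPart (f.deriv y) :=
    fun x hx y hy => by simp only [F, diskRetraction_of_mem hx, diskRetraction_of_mem hy]
  obtain ⟨M, hM⟩ := (isCompact_disk.prod isCompact_disk).exists_bound_of_continuousOn
    hL.continuousOn
  refine ⟨fun x y => L (x, y) + (N (x, y) / F (x, y)).arg, M + π, fun x => ?_,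
    fun x hx y hy => ?_, fun y hy => ?_, fun x hx y hy hne => ?_⟩
  · have h1 : Measurable fun y => N (x, y) := (by fun_prop : Continuous fun y => N (x, y)).measurable
    have h2 : Measurable fun y => F (x, y) := (by fun_prop : Continuous fun y => F (x, y)).measurable
    have h3 : Measurable fun y => L (x, y) := (by fun_prop : Continuous fun y => L (x, y)).measurable
    exact h3.add (Complex.measurable_arg.comp (h1.div h2))
  · exact (abs_add_le _ _).trans (add_le_add (hM (x, y) ⟨hx, hy⟩) (Complex.abs_arg_le_pi _))
  · refine (by fun_prop : Continuous fun x => L (x, y)).continuousOn.add fun x hx => ?_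
    have h1 : ContinuousAt (fun x => N (x, y) / F (x, y)) x :=
      (by fun_prop : Continuous fun x => N (x, y)).continuousAt.div
        (by fun_prop : Continuous fun x => F (x, y)).continuousAt (hang _).ne_zero
    refine ((Complex.continuousAt_arg (Or.inl ?_)).comp
      (f := fun x => N (x, y) / F (x, y)) h1).continuousWithinAt
    rw [hFd x hx.1 y hy]
    exact (hη x hx.1 y hy).2 hx.2
  · have hN0 : N (x, y) / F (x, y) ≠ 0 := fun h => by
      have := (hη x hx y hy).2 hne
      change 0 < (N (x, y) / _).re at this
      rw [← hFd x hx y hy, h] at this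
      simp at this
    have h1 := (hang (x, y)).mul (IsAngle.arg hN0)
    rw [mul_div_cancel₀ _ (hang (x, y)).ne_zero] at h1
    have hxy : x - y ≠ 0 := sub_ne_zero.2 hne
    have hsq : 0 < (‖x - y‖ ^ 2)⁻¹ := by positivity
    convert h1.pos_mul hsq using 1
    have h2 : ((‖x - y‖ ^ 2 : ℝ) : ℂ) = (x - y) * (starRingEnd ℂ) (x - y) := by
      rw [Complex.mul_conj, Complex.normSq_eq_norm_sq]
    have h3 : (starRingEnd ℂ) (x - y) ≠ 0 := (map_ne_zero _).2 hxy
    rw [Complex.ofReal_inv, h2]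
    simp only [N]
    field_simp

end SympDiff

theorem IsAngle.hasDerivAt {φ : ℝ → ℂ} {φ' : ℂ} {θ : ℝ → ℝ} {t : ℝ} (hφ : HasDerivAt φ φ' t)
    (hθ : ContinuousAt θ t) (h : ∀ᶠ s in 𝓝 t, IsAngle (φ s) (θ s)) :
    HasDerivAt θ (φ' / φ t).im t := by
  have h0 := h.self_of_nhds
  have h1 : HasDerivAt (fun s => φ s / φ t) (φ' / φ t) t := hφ.div_const _
  have h2 : HasDerivAt (fun s => Complex.log (φ s / φ t)) (φ' / φ t) t := by
    simpa [div_self h0.ne_zero] using h1.clog_real (by simp [div_self h0.ne_zero])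
  have h3 : HasDerivAt (fun s => (Complex.log (φ s / φ t)).im + θ t) (φ' / φ t).im t :=
    (Complex.imCLM.hasFDerivAt.comp_hasDerivAt t h2).add_const (θ t)
  refine h3.congr_of_eventuallyEq ?_
  have h4 : ∀ᶠ s in 𝓝 t, |θ s - θ t| < π := by
    have := Metric.continuousAt_iff'.1 hθ π Real.pi_pos
    simpa [Real.dist_eq] using this
  filter_upwards [h, h4] with s hs hs'
  rw [Complex.log_im, ← hs.sub_eq_arg_div h0 hs']
  ring

theorem IsAngle.integral_eq_sub {φ φ' : ℝ → ℂ} {θ : ℝ → ℝ}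
    (hφ : ∀ t ∈ Ioo (0 : ℝ) 1, HasDerivAt φ (φ' t) t) (hθ : ContinuousOn θ (Icc 0 1))
    (h : ∀ t ∈ Icc (0 : ℝ) 1, IsAngle (φ t) (θ t))
    (hint : IntervalIntegrable (fun t => (φ' t / φ t).im) volume 0 1) :
    ∫ t in (0 : ℝ)..1, (φ' t / φ t).im = θ 1 - θ 0 := by
  refine intervalIntegral.integral_eq_sub_of_hasDerivAt_of_le zero_le_one hθ (fun t ht => ?_) hint
  have hn : Icc (0 : ℝ) 1 ∈ 𝓝 t := Icc_mem_nhds ht.1 ht.2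
  exact IsAngle.hasDerivAt (hφ t ht) (hθ.continuousAt hn) (eventually_of_mem hn h)

theorem ae_notMem_segment (x x' : ℂ) : ∀ᵐ y : ℂ, y ∉ segment ℝ x x' := by
  refine measure_mono_null (t := (affineSpan ℝ {x, x'} : Set ℂ)) (fun y hy => ?_) ?_
  · have hy : y ∈ segment ℝ x x' := by simpa using hy
    exact convexHull_subset_affineSpan _ (by rwa [convexHull_pair])
  · refine Measure.addHaar_affineSubspace _ _ fun htop => ?_
    have h1 := (collinear_pair ℝ x x').finrank_le_one
    rw [← direction_affineSpan, htop, AffineSubspace.direction_top, finrank_top,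
      Complex.finrank_real_complex] at h1
    omega

theorem lform_eq (z w : ℂ) : lform z w = (w * (starRingEnd ℂ) z).im / (2 * π) := by
  simp [lform]
  ring

namespace SympDiff

variable (f : SympDiff)

theorem integrableOn_inv_extend_sub (x : ℂ) :
    IntegrableOn (fun y => (f.extend x - f.extend y)⁻¹) Disk :=
  f.measurePreserving_extend.integrable_comp_of_integrable
    (g := fun y => (f.extend x - y)⁻¹) (integrableOn_inv_sub (f.extend_mem x))

theorem integral_comp_extend {g : ℂ → ℝ} (hg : Measurable g) :
    ∫ y in Disk, g (f.extend y) = ∫ y in Disk, g y := by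
  conv_rhs => rw [← f.measurePreserving_extend.map_eq]
  rw [integral_map f.continuous_extend.aemeasurable hg.aestronglyMeasurable]

theorem integral_inv_extend_sub (x : ℂ) :
    ∫ y in Disk, (f.extend x - f.extend y)⁻¹ = π * (starRingEnd ℂ) (f.extend x) := by
  rw [← integral_disk_inv_sub (f.extend_mem x)]
  conv_rhs => rw [← f.measurePreserving_extend.map_eq]
  rw [integral_map f.continuous_extend.aemeasurable (by fun_prop)]

theorem integral_norm_inv_extend_sub_le (x : ℂ) :
    ∫ y in Disk, ‖f.extend x - f.extend y‖⁻¹ ≤ kernelBound := by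
  rw [f.integral_comp_extend (g := fun y => ‖f.extend x - y‖⁻¹) (by fun_prop)]
  exact (integrableOn_inv_norm_sub (f.extend_mem x)).2

/-- The logarithmic derivative of the difference quotient, averaged over the second point. -/
theorem integral_log_deriv {x : ℂ} (hx : x ∈ Disk) (w : ℂ) :
    ∫ y in Disk, (f.deriv x w / (f.extend x - f.extend y) - w / (x - y)).im =
      2 * π ^ 2 * (lform (f.extend x) (f.deriv x w) - lform x w) := by
  have h1 := (f.integrableOn_inv_extend_sub x).const_mul (f.deriv x w)
  have h2 := (integrableOn_inv_sub hx).const_mul w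
  simp only [div_eq_mul_inv]
  have h3 := Complex.imCLM.integral_comp_comm (h1.sub h2)
  simp only [Complex.imCLM_apply, Pi.sub_apply] at h3
  rw [h3, integral_sub h1 h2, integral_const_mul, integral_const_mul,
    f.integral_inv_extend_sub x, integral_disk_inv_sub hx, lform_eq, lform_eq, Complex.sub_im,
    mul_left_comm, mul_left_comm w, Complex.im_ofReal_mul, Complex.im_ofReal_mul]
  field_simp

end SympDiff

theorem hasDerivAt_add_smul (x w : ℂ) (t : ℝ) : HasDerivAt (fun s : ℝ => x + s • w) w t := by
  simpa using ((hasDerivAt_id t).smul_const w).const_add x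

theorem HasFDerivWithinAt.hasDerivAt_segment {E : Type*} [NormedAddCommGroup E] [NormedSpace ℝ E]
    {g : ℂ → E} {x x' : ℂ} (hx : x ∈ Disk) (hx' : x' ∈ Disk) {t : ℝ} (ht : t ∈ Ioo (0 : ℝ) 1)
    {g' : ℂ →L[ℝ] E} (hg : HasFDerivWithinAt g g' Disk (x + t • (x' - x))) :
    HasDerivAt (fun s : ℝ => g (x + s • (x' - x))) (g' (x' - x)) t := by
  have h1 := (hasDerivAt_add_smul x (x' - x) t).hasDerivWithinAt (s := Icc 0 1)
  exact (hg.comp_hasDerivWithinAt t h1 fun s hs => convex_disk.add_smul_sub_mem hx hx' hs).hasDerivAt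
    (Icc_mem_nhds ht.1 ht.2)

namespace SympDiff

variable (f : SympDiff)

theorem continuous_deriv_diskRetraction : Continuous fun z => f.deriv (diskRetraction z) :=
  f.continuousOn_deriv.comp_continuous continuous_diskRetraction diskRetraction_mem

theorem integral_lform_segment {A : ℂ → ℝ} (hA : IsAction f A) {x x' : ℂ} (hx : x ∈ Disk)
    (hx' : x' ∈ Disk) :
    ∫ t in (0 : ℝ)..1, (lform (f.extend (x + t • (x' - x)))
      (f.deriv (x + t • (x' - x)) (x' - x)) - lform (x + t • (x' - x)) (x' - x)) = A x' - A x := by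
  have hseg : MapsTo (fun t : ℝ => x + t • (x' - x)) (Icc 0 1) Disk :=
    fun t ht => convex_disk.add_smul_sub_mem hx hx' ht
  have hsegc : Continuous fun t : ℝ => x + t • (x' - x) := by fun_prop
  have h := intervalIntegral.integral_eq_sub_of_hasDerivAt_of_le zero_le_one
    (hA.1.continuousOn.comp hsegc.continuousOn hseg)
    (f' := fun t => lform (f.extend (x + t • (x' - x)))
      (f.deriv (x + t • (x' - x)) (x' - x)) - lform (x + t • (x' - x)) (x' - x))
    (fun t ht => ?_) ?_
  · simpa using h
  · have hm := hseg (Ioo_subset_Icc_self ht)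
    have h1 := (hA.1.differentiableOn one_ne_zero _ hm).hasFDerivWithinAt.hasDerivAt_segment
      hx hx' ht
    rw [hA.2 _ hm, ← f.extend_of_mem hm] at h1
    exact h1
  · refine ContinuousOn.intervalIntegrable ?_
    rw [uIcc_of_le zero_le_one]
    have h2 : ContinuousOn (fun t : ℝ => f.deriv (x + t • (x' - x)) (x' - x)) (Icc 0 1) :=
      (f.continuousOn_deriv.comp hsegc.continuousOn hseg).clm_apply continuousOn_const
    have h3 : Continuous fun t : ℝ => f.extend (x + t • (x' - x)) :=
      f.continuous_extend.comp hsegc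
    have h4 := h3.continuousOn (s := Icc (0 : ℝ) 1)
    simp only [lform]
    refine ContinuousOn.sub ?_ (by fun_prop)
    refine ContinuousOn.div_const (ContinuousOn.sub ?_ ?_) _
    · exact (Complex.continuous_re.comp_continuousOn h4).mul
        (Complex.continuous_im.comp_continuousOn h2)
    · exact (Complex.continuous_im.comp_continuousOn h4).mul
        (Complex.continuous_re.comp_continuousOn h2)

/-- The action difference is the average over `y` of the variation of the angle at `y`. -/
theorem integral_angle_sub {A : ℂ → ℝ} (hA : IsAction f A) {θ : ℂ → ℂ → ℝ}
    (hθ : ∀ y ∈ Disk, ContinuousOn (fun x => θ x y) (Disk \ {y}))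
    (hang : ∀ x ∈ Disk, ∀ y ∈ Disk, x ≠ y →
      IsAngle ((f.extend x - f.extend y) / (x - y)) (θ x y))
    {x x' : ℂ} (hx : x ∈ Disk) (hx' : x' ∈ Disk) :
    ∫ y in Disk, (θ x' y - θ x y) = 2 * π ^ 2 * (A x' - A x) := by
  set w := x' - x with hw
  have hsegc : Continuous fun t : ℝ => x + t • w := by fun_prop
  have hseg : ∀ t ∈ Icc (0 : ℝ) 1, x + t • w ∈ Disk :=
    fun t ht => convex_disk.add_smul_sub_mem hx hx' ht
  obtain ⟨K, hK0, hK⟩ := f.exists_norm_deriv_le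
  let D : ℝ → ℂ := fun t => f.deriv (diskRetraction (x + t • w)) w
  have hD : Continuous D := (f.continuous_deriv_diskRetraction.comp hsegc).clm_apply
    continuous_const
  have hDe : ∀ t ∈ Icc (0 : ℝ) 1, D t = f.deriv (x + t • w) w := fun t ht => by
    simp only [D, diskRetraction_of_mem (hseg t ht)]
  let Φ : ℝ → ℂ → ℝ := fun t y =>
    (D t / (f.extend (x + t • w) - f.extend y) - w / (x + t • w - y)).im
  have hfc := f.continuous_extend
  have hΦm : Measurable (Function.uncurry Φ) := by
    have h1 : Measurable fun p : ℝ × ℂ => D p.1 := hD.measurable.comp measurable_fst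
    have h2 : Measurable fun p : ℝ × ℂ => f.extend (x + p.1 • w) - f.extend p.2 :=
      (by fun_prop : Continuous fun p : ℝ × ℂ => f.extend (x + p.1 • w) - f.extend p.2).measurable
    have h3 : Measurable fun p : ℝ × ℂ => x + p.1 • w - p.2 :=
      (by fun_prop : Continuous fun p : ℝ × ℂ => x + p.1 • w - p.2).measurable
    exact Complex.measurable_im.comp ((h1.div h2).sub (measurable_const.div h3))
  have hang_sub : ∀ᵐ y ∂volume.restrict Disk,
      θ x' y - θ x y = ∫ t in (0 : ℝ)..1, Φ t y := by
    filter_upwards [ae_restrict_mem measurableSet_disk, ae_restrict_of_ae (ae_notMem_segment x x')]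
      with y hy hys
    have hne : ∀ t ∈ Icc (0 : ℝ) 1, x + t • w ≠ y := fun t ht h => hys (by
      rw [segment_eq_image']
      exact ⟨t, ht, h⟩)
    have hne' : ∀ t ∈ Icc (0 : ℝ) 1, f.extend (x + t • w) - f.extend y ≠ 0 := fun t ht h =>
      hne t ht (f.injOn_extend (hseg t ht) hy (sub_eq_zero.1 h))
    have hq : ∀ t ∈ Icc (0 : ℝ) 1, x + t • w - y ≠ 0 := fun t ht => sub_ne_zero.2 (hne t ht)
    let φ : ℝ → ℂ := fun t => (f.extend (x + t • w) - f.extend y) / (x + t • w - y)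
    let φ' : ℝ → ℂ := fun t => (D t * (x + t • w - y) - (f.extend (x + t • w) - f.extend y) * w) /
      (x + t • w - y) ^ 2
    have hΦ : ∀ t ∈ Icc (0 : ℝ) 1, Φ t y = (φ' t / φ t).im := fun t ht => by
      have h1 := hne' t ht
      have h2 := hq t ht
      simp only [Φ, φ, φ']
      congr 1
      field_simp
    have hΦc : ContinuousOn (fun t => Φ t y) (Icc 0 1) := by
      refine Complex.continuous_im.comp_continuousOn (ContinuousOn.sub ?_ ?_)
      · exact hD.continuousOn.div (by fun_prop) hne'
      · exact continuousOn_const.div (by fun_prop) hq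
    have hΦi : IntervalIntegrable (fun t => (φ' t / φ t).im) volume 0 1 := by
      refine ContinuousOn.intervalIntegrable ?_
      rw [uIcc_of_le zero_le_one]
      exact hΦc.congr fun t ht => (hΦ t ht).symm
    have h := IsAngle.integral_eq_sub (φ := φ) (φ' := φ') (θ := fun t => θ (x + t • w) y)
      (fun t ht => ?_) ?_ (fun t ht => hang _ (hseg t ht) y hy (hne t ht)) hΦi
    · simp only [one_smul, zero_smul, add_zero, hw, add_sub_cancel] at h
      rw [← h]
      refine intervalIntegral.integral_congr fun t ht => ?_
      rw [uIcc_of_le zero_le_one] at ht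
      exact (hΦ t ht).symm
    · have ht' := Ioo_subset_Icc_self ht
      have h1 := (f.hasFDerivWithinAt (hseg t ht')).hasDerivAt_segment hx hx' ht
      rw [← hw, ← hDe t ht'] at h1
      exact (h1.sub_const _).div ((hasDerivAt_add_smul x w t).sub_const y) (hq t ht')
    · exact (hθ y hy).comp hsegc.continuousOn fun t ht => ⟨hseg t ht, hne t ht⟩
  have hΦy : ∀ t ∈ Icc (0 : ℝ) 1, ∫ y in Disk, Φ t y =
      2 * π ^ 2 * (lform (f.extend (x + t • w)) (f.deriv (x + t • w) w) - lform (x + t • w) w) :=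
    fun t ht => by
      rw [← f.integral_log_deriv (hseg t ht)]
      simp only [Φ, hDe t ht]
  have hbound : ∀ t ∈ Icc (0 : ℝ) 1, ∀ y, ‖Φ t y‖ ≤
      (K * ‖w‖) * ‖f.extend (x + t • w) - f.extend y‖⁻¹ + ‖w‖ * ‖x + t • w - y‖⁻¹ :=
    fun t ht y => by
      refine (Complex.abs_im_le_norm _).trans ((norm_sub_le _ _).trans ?_)
      rw [norm_div, norm_div, div_eq_mul_inv, div_eq_mul_inv, hDe t ht]
      gcongr
      exact (f.deriv _).le_of_opNorm_le (hK _ (hseg t ht)) w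
  have hdom : ∀ t ∈ Icc (0 : ℝ) 1, IntegrableOn (fun y =>
      (K * ‖w‖) * ‖f.extend (x + t • w) - f.extend y‖⁻¹ + ‖w‖ * ‖x + t • w - y‖⁻¹) Disk :=
    fun t ht => by
      have h1 := (f.integrableOn_inv_extend_sub (x + t • w)).norm
      simp only [norm_inv] at h1
      exact (h1.const_mul _).add ((integrableOn_inv_norm_sub (hseg t ht)).1.const_mul _)
  have hΦint : ∀ t ∈ Icc (0 : ℝ) 1, Integrable (Φ t) (volume.restrict Disk) := fun t ht =>
    (hdom t ht).mono' (hΦm.comp measurable_prodMk_left).aestronglyMeasurable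
      (ae_of_all _ (hbound t ht))
  have hprod : Integrable (Function.uncurry Φ)
      ((volume.restrict (Ioc (0 : ℝ) 1)).prod (volume.restrict Disk)) := by
    rw [integrable_prod_iff hΦm.aestronglyMeasurable]
    constructor
    · filter_upwards [ae_restrict_mem measurableSet_Ioc] with t ht
      exact hΦint t (Ioc_subset_Icc_self ht)
    · refine Integrable.mono' (g := fun _ => (K * ‖w‖) * kernelBound + ‖w‖ * kernelBound)
        (integrable_const _)
        hΦm.aestronglyMeasurable.norm.integral_prod_right' ?_
      filter_upwards [ae_restrict_mem measurableSet_Ioc] with t ht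
      have ht := Ioc_subset_Icc_self ht
      rw [Real.norm_of_nonneg (integral_nonneg fun _ => norm_nonneg _)]
      refine (integral_mono (hΦint t ht).norm (hdom t ht) (hbound t ht)).trans ?_
      have h1 := (f.integrableOn_inv_extend_sub (x + t • w)).norm
      simp only [norm_inv] at h1
      have h2 := integrableOn_inv_norm_sub (hseg t ht)
      rw [integral_add (h1.const_mul _) (h2.1.const_mul _), integral_const_mul,
        integral_const_mul]
      gcongr
      · exact f.integral_norm_inv_extend_sub_le _
      · exact h2.2
  rw [integral_congr_ae hang_sub]
  simp only [intervalIntegral.integral_of_le zero_le_one]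
  rw [← integral_integral_swap hprod,
    setIntegral_congr_fun measurableSet_Ioc fun t ht => hΦy t (Ioc_subset_Icc_self ht),
    integral_const_mul, ← f.integral_lform_segment hA hx hx',
    intervalIntegral.integral_of_le zero_le_one]

end SympDiff

theorem eq_of_continuousOn_of_two_pi_mul_int {h : ℝ → ℝ} (hc : ContinuousOn h (Icc 0 1))
    (hn : ∀ t ∈ Icc (0 : ℝ) 1, ∃ n : ℤ, h t = n * (2 * π)) : h 0 = h 1 := by
  refine isPreconnected_Icc.constant_of_mapsTo
    (T := (AddSubgroup.zmultiples (2 * π) : Set ℝ))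
    (SetLike.isDiscrete_iff_discreteTopology.2 inferInstance) hc (fun t ht => ?_)
    (left_mem_Icc.2 zero_le_one) (right_mem_Icc.2 zero_le_one)
  obtain ⟨n, h⟩ := hn t ht
  exact ⟨n, by simp [h]⟩

namespace SympDiff

variable (f : SympDiff)

theorem extend_iterate_injOn (n : ℕ) : InjOn f.extend^[n] Disk :=
  f.injOn_extend.iterate (fun z _ => f.extend_mem z) n

theorem isAngle_sum {θ : ℂ → ℂ → ℝ} (hang : ∀ x ∈ Disk, ∀ y ∈ Disk, x ≠ y →
      IsAngle ((f.extend x - f.extend y) / (x - y)) (θ x y)) (n : ℕ) {x y : ℂ} (hx : x ∈ Disk)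
    (hy : y ∈ Disk) (hne : x ≠ y) :
    IsAngle ((f.extend^[n] x - f.extend^[n] y) / (x - y))
      (∑ i ∈ Finset.range n, θ (f.extend^[i] x) (f.extend^[i] y)) := by
  induction n with
  | zero => simpa [div_self (sub_ne_zero.2 hne)] using IsAngle.one
  | succ n ih =>
    rw [Finset.sum_range_succ, Function.iterate_succ_apply', Function.iterate_succ_apply']
    have hne' : f.extend^[n] x ≠ f.extend^[n] y := fun h =>
      hne (f.extend_iterate_injOn n hx hy h)
    have h := ih.mul (hang _ (f.extend_iterate_mem n hx) _ (f.extend_iterate_mem n hy) hne')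
    have h1 := sub_ne_zero.2 hne'
    convert h using 1
    field_simp

/-- Uniform closeness to the identity controls the variation of the angle along a segment
avoiding `y`. -/
theorem tendsto_sum_angle_sub {θ : ℂ → ℂ → ℝ}
    (hθ : ∀ y ∈ Disk, ContinuousOn (fun x => θ x y) (Disk \ {y}))
    (hang : ∀ x ∈ Disk, ∀ y ∈ Disk, x ≠ y →
      IsAngle ((f.extend x - f.extend y) / (x - y)) (θ x y))
    {q : ℕ → ℕ} {ε : ℕ → ℝ} (hε : Tendsto ε atTop (𝓝 0))
    (hq : ∀ k, ∀ z ∈ Disk, ‖f.extend^[q k] z - z‖ ≤ ε k)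
    {x x' y : ℂ} (hx : x ∈ Disk) (hx' : x' ∈ Disk) (hy : y ∈ Disk) (hys : y ∉ segment ℝ x x') :
    Tendsto (fun k => ∑ i ∈ Finset.range (q k), θ (f.extend^[i] x') (f.extend^[i] y) -
      ∑ i ∈ Finset.range (q k), θ (f.extend^[i] x) (f.extend^[i] y)) atTop (𝓝 0) := by
  let ratio : ℕ → ℂ → ℂ := fun k z => (f.extend^[q k] z - f.extend^[q k] y) / (z - y)
  have hseg : ∀ t ∈ Icc (0 : ℝ) 1, x + t • (x' - x) ∈ Disk :=
    fun t ht => convex_disk.add_smul_sub_mem hx hx' ht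
  have hsegc : Continuous fun t : ℝ => x + t • (x' - x) := by fun_prop
  have hne : ∀ t ∈ Icc (0 : ℝ) 1, x + t • (x' - x) ≠ y := fun t ht h => hys (by
    rw [segment_eq_image']
    exact ⟨t, ht, h⟩)
  obtain ⟨δ, hδ, hδy⟩ : ∃ δ > 0, ∀ t ∈ Icc (0 : ℝ) 1, δ ≤ ‖x + t • (x' - x) - y‖ :=
    isCompact_Icc.exists_forall_le' (a := 0) (by fun_prop) fun t ht =>
      norm_pos_iff.2 (sub_ne_zero.2 (hne t ht))
  have hratio : ∀ k, ∀ z ∈ Disk, δ ≤ ‖z - y‖ → ‖ratio k z - 1‖ ≤ 2 * ε k / δ :=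
    fun k z hz hzy => by
      have h0 : z - y ≠ 0 := norm_pos_iff.1 (hδ.trans_le hzy)
      have h1 : ratio k z - 1 = ((f.extend^[q k] z - z) - (f.extend^[q k] y - y)) / (z - y) := by
        simp only [ratio]
        field_simp
        ring
      have h2 : ‖(f.extend^[q k] z - z) - (f.extend^[q k] y - y)‖ ≤ 2 * ε k := by
        linarith [norm_sub_le (f.extend^[q k] z - z) (f.extend^[q k] y - y), hq k z hz, hq k y hy]
      rw [h1, norm_div]
      exact div_le_div₀ ((norm_nonneg _).trans h2) h2 hδ hzy
  have hlim : Tendsto (fun k => 2 * ε k / δ) atTop (𝓝 0) := by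
    simpa using (hε.const_mul 2).div_const δ
  have harg : ∀ z ∈ Disk, δ ≤ ‖z - y‖ → Tendsto (fun k => (ratio k z).arg) atTop (𝓝 0) :=
    fun z hz hzy => by
      have h1 : Tendsto (fun k => ratio k z) atTop (𝓝 1) :=
        tendsto_iff_norm_sub_tendsto_zero.2
          (squeeze_zero (fun _ => norm_nonneg _) (fun k => hratio k z hz hzy) hlim)
      simpa [Function.comp_def] using (Complex.continuousAt_arg (x := 1) (by simp)).tendsto.comp h1
  have hδx := hδy 0 (left_mem_Icc.2 zero_le_one)
  have hδx' := hδy 1 (right_mem_Icc.2 zero_le_one)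
  simp only [zero_smul, add_zero] at hδx
  simp only [one_smul, add_sub_cancel] at hδx'
  have hfin := (harg x' hx' hδx').sub (harg x hx hδx)
  rw [sub_zero] at hfin
  refine hfin.congr' ?_
  filter_upwards [hlim.eventually (gt_mem_nhds one_pos)] with k hk
  have hcont : ContinuousOn (fun z => ∑ i ∈ Finset.range (q k),
      θ (f.extend^[i] z) (f.extend^[i] y)) (Disk \ {y}) := by
    refine continuousOn_finsetSum _ fun i _ => ?_
    refine (hθ _ (f.extend_iterate_mem i hy)).comp (f.continuous_extend.iterate i).continuousOn
      fun z hz => ⟨f.extend_iterate_mem i hz.1, fun h => hz.2 (f.extend_iterate_injOn i hz.1 hy h)⟩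
  have hmaps : MapsTo (fun t : ℝ => x + t • (x' - x)) (Icc 0 1) (Disk \ {y}) :=
    fun t ht => ⟨hseg t ht, hne t ht⟩
  have hrc : ContinuousOn (fun t : ℝ => (ratio k (x + t • (x' - x))).arg) (Icc 0 1) := by
    have h1 : ContinuousOn (fun t : ℝ => ratio k (x + t • (x' - x))) (Icc 0 1) := by
      have := f.continuous_extend.iterate (q k)
      exact ContinuousOn.div (by fun_prop) (by fun_prop) fun t ht => sub_ne_zero.2 (hne t ht)
    intro t ht
    refine ContinuousAt.comp_continuousWithinAt (g := Complex.arg)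
      (Complex.continuousAt_arg ?_) (h1 t ht)
    refine Complex.ball_one_subset_slitPlane ?_
    rw [mem_ball_iff_norm]
    exact (hratio k _ (hseg t ht) (hδy t ht)).trans_lt hk
  have hconst := eq_of_continuousOn_of_two_pi_mul_int
    ((hcont.comp hsegc.continuousOn hmaps).sub hrc) fun t ht => by
      have h1 := f.isAngle_sum hang (q k) (hseg t ht) hy (hne t ht)
      exact h1.sub_eq_two_pi_mul_int (IsAngle.arg h1.ne_zero)
  simp only [Pi.sub_apply, Function.comp_apply, zero_smul, add_zero, one_smul, add_sub_cancel] at hconst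
  linarith

theorem integral_sum_angle_sub {A : ℂ → ℝ} (hA : IsAction f A) {θ : ℂ → ℂ → ℝ} {M : ℝ}
    (hm : ∀ x, Measurable (θ x)) (hM : ∀ x ∈ Disk, ∀ y ∈ Disk, |θ x y| ≤ M)
    (hθ : ∀ y ∈ Disk, ContinuousOn (fun x => θ x y) (Disk \ {y}))
    (hang : ∀ x ∈ Disk, ∀ y ∈ Disk, x ≠ y →
      IsAngle ((f.extend x - f.extend y) / (x - y)) (θ x y)) (n : ℕ)
    {x x' : ℂ} (hx : x ∈ Disk) (hx' : x' ∈ Disk) :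
    ∫ y in Disk, (∑ i ∈ Finset.range n, θ (f.extend^[i] x') (f.extend^[i] y) -
      ∑ i ∈ Finset.range n, θ (f.extend^[i] x) (f.extend^[i] y)) =
    2 * π ^ 2 * (∑ i ∈ Finset.range n, A (f.extend^[i] x') -
      ∑ i ∈ Finset.range n, A (f.extend^[i] x)) := by
  have hfin : IsFiniteMeasure (volume.restrict Disk) :=
    ⟨by simpa using isCompact_disk.measure_lt_top⟩
  simp only [← Finset.sum_sub_distrib]
  rw [Finset.mul_sum, integral_finsetSum]
  · refine Finset.sum_congr rfl fun i _ => ?_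
    rw [← f.integral_angle_sub hA hθ hang (f.extend_iterate_mem i hx)
      (f.extend_iterate_mem i hx')]
    have hmp := f.measurePreserving_extend.iterate i
    conv_rhs => rw [← hmp.map_eq]
    have hmm : Measurable fun y => θ (f.extend^[i] x') y - θ (f.extend^[i] x) y :=
      (hm _).sub (hm _)
    rw [integral_map hmp.measurable.aemeasurable hmm.aestronglyMeasurable]
  · intro i _
    have hmi : Measurable f.extend^[i] := (f.continuous_extend.iterate i).measurable
    refine Integrable.mono' (integrable_const (2 * M))
      (((hm _).comp hmi).sub ((hm _).comp hmi)).aestronglyMeasurable ?_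
    filter_upwards [ae_restrict_mem measurableSet_disk] with y hy
    have h1 := hM _ (f.extend_iterate_mem i hx) _ (f.extend_iterate_mem i hy)
    have h2 := hM _ (f.extend_iterate_mem i hx') _ (f.extend_iterate_mem i hy)
    refine (abs_sub _ _).trans ?_
    linarith

theorem tendsto_birkhoff_sub {A : ℂ → ℝ} (hA : IsAction f A) {q : ℕ → ℕ} (hq0 : ∀ k, 0 < q k)
    {ε : ℕ → ℝ} (hε : Tendsto ε atTop (𝓝 0))
    (hq : ∀ k, ∀ z ∈ Disk, ‖f.extend^[q k] z - z‖ ≤ ε k)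
    {x x' : ℂ} (hx : x ∈ Disk) (hx' : x' ∈ Disk) :
    Tendsto (fun k => (q k : ℝ)⁻¹ * (∑ i ∈ Finset.range (q k), A (f.extend^[i] x') -
      ∑ i ∈ Finset.range (q k), A (f.extend^[i] x))) atTop (𝓝 0) := by
  obtain ⟨θ, M, hm, hM, hθ, hang⟩ := f.exists_angle
  have hfin : IsFiniteMeasure (volume.restrict Disk) :=
    ⟨by simpa using isCompact_disk.measure_lt_top⟩
  have hlim : Tendsto (fun k => ∫ y in Disk, (q k : ℝ)⁻¹ *
      (∑ i ∈ Finset.range (q k), θ (f.extend^[i] x') (f.extend^[i] y) -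
      ∑ i ∈ Finset.range (q k), θ (f.extend^[i] x) (f.extend^[i] y))) atTop
      (𝓝 (∫ _ in Disk, (0 : ℝ))) := by
    refine tendsto_integral_of_dominated_convergence (fun _ => 2 * M) (fun k => ?_)
      (integrable_const _) (fun k => ?_) ?_
    · refine Measurable.aestronglyMeasurable ?_
      have hmi : ∀ i z, Measurable fun y => θ z (f.extend^[i] y) := fun i z =>
        (hm z).comp (f.continuous_extend.iterate i).measurable
      fun_prop
    · filter_upwards [ae_restrict_mem measurableSet_disk] with y hy
      have hb : ∀ z ∈ Disk, |∑ i ∈ Finset.range (q k), θ (f.extend^[i] z) (f.extend^[i] y)| ≤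
          q k * M := fun z hz => by
        refine (Finset.abs_sum_le_sum_abs _ _).trans ?_
        refine (Finset.sum_le_sum fun i _ => hM _ (f.extend_iterate_mem i hz) _
          (f.extend_iterate_mem i hy)).trans ?_
        simp
      have hk : (0 : ℝ) < q k := by exact_mod_cast hq0 k
      rw [norm_mul, Real.norm_of_nonneg (by positivity), inv_mul_le_iff₀ hk]
      refine (abs_sub _ _).trans ?_
      linarith [hb x hx, hb x' hx']
    · filter_upwards [ae_restrict_mem measurableSet_disk,
        ae_restrict_of_ae (ae_notMem_segment x x')] with y hy hys
      have h := (f.tendsto_sum_angle_sub hθ hang hε hq hx hx' hy hys).abs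
      rw [abs_zero] at h
      refine squeeze_zero_norm (fun k => ?_) h
      have hk : (1 : ℝ) ≤ q k := by exact_mod_cast hq0 k
      rw [norm_mul, Real.norm_of_nonneg (by positivity), Real.norm_eq_abs]
      exact mul_le_of_le_one_left (abs_nonneg _) (inv_le_one_of_one_le₀ hk)
  have h := hlim.const_mul (2 * π ^ 2)⁻¹
  simp only [integral_const_mul, f.integral_sum_angle_sub hA hm hM hθ hang _ hx hx',
    integral_zero, mul_zero] at h
  refine h.congr fun k => ?_
  field_simp

end SympDiff

theorem norm_iterate_sub_le_d0 (f : SympDiff) (n : ℕ) {z : ℂ} (hz : z ∈ Disk) :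
    ‖f.extend^[n] z - z‖ ≤ d0 (f.toFun^[n]) (f.invFun^[n]) id id := by
  rw [f.extend_iterate_of_mem n hz]
  refine le_max_of_le_left ?_
  refine le_ciSup (f := fun z : Disk => ‖f.toFun^[n] (z : ℂ) - id (z : ℂ)‖) ⟨2, ?_⟩ ⟨z, hz⟩
  rintro _ ⟨w, rfl⟩
  have h1 := mem_disk.1 (f.mapsTo.iterate n w.2)
  have h2 := mem_disk.1 w.2
  simp only [id]
  linarith [norm_sub_le (f.toFun^[n] w) (w : ℂ)]

/-- If some sequence of iterates of `f` converges to the identity in the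
`C⁰` topology, then `Cal₁(f) = 0`. -/
theorem cal_C0_rigidity (f : SympDiff) (q : ℕ → ℕ) (hq : ∀ k, 0 < q k)
    (hconv : Filter.Tendsto
      (fun k => d0 (f.toFun^[q k]) (f.invFun^[q k]) id id) Filter.atTop (nhds 0))
    (A : ℂ → ℝ) (hA : IsNormalizedAction f A) :
    (1 / Real.pi) * ∫ z in Disk, A z = 0 := by
  obtain ⟨hA, μ, hμ, hμA⟩ := hA
  have hprob := hμ.1
  have hfin : IsFiniteMeasure (volume.restrict Disk) :=
    ⟨by simpa using isCompact_disk.measure_lt_top⟩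
  have hμD : ∀ᵐ z ∂μ, z ∈ Disk := by
    have h : ∀ᵐ z ∂μ, z ∈ Circ := by
      rw [ae_iff]; exact hμ.2.1
    exact h.mono fun z hz => sphere_subset_closedBall hz
  let B : ℂ → ℝ := fun z => A (diskRetraction z)
  have hB : Continuous B :=
    hA.1.continuousOn.comp_continuous continuous_diskRetraction diskRetraction_mem
  have hBA : ∀ z ∈ Disk, B z = A z := fun z hz => by simp only [B, diskRetraction_of_mem hz]
  obtain ⟨C, hC⟩ := isCompact_disk.exists_bound_of_continuousOn hA.1.continuousOn
  have hBC : ∀ z, |B z| ≤ C := fun z => hC _ (diskRetraction_mem z)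
  let S : ℕ → ℂ → ℝ := fun k z => (q k : ℝ)⁻¹ * ∑ i ∈ Finset.range (q k), B (f.extend^[i] z)
  have hS : ∀ k, Continuous (S k) := fun k =>
    continuous_const.mul (continuous_finsetSum _ fun i _ =>
      hB.comp (f.continuous_extend.iterate i))
  have hSC : ∀ k z, ‖S k z‖ ≤ C := fun k z => by
    have hk : (0 : ℝ) < q k := by exact_mod_cast hq k
    rw [norm_mul, Real.norm_of_nonneg (by positivity), inv_mul_le_iff₀ hk]
    refine (norm_sum_le _ _).trans ((Finset.sum_le_sum fun i _ => hBC _).trans ?_)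
    simp
  have hint : ∀ (ν : Measure ℂ) [IsFiniteMeasure ν], MeasurePreserving f.extend ν ν →
      ∀ k, ∫ z, S k z ∂ν = ∫ z, B z ∂ν := fun ν _ hν k => by
    have hBi : ∀ i, ∫ z, B (f.extend^[i] z) ∂ν = ∫ z, B z ∂ν := fun i => by
      have hi := hν.iterate i
      conv_rhs => rw [← hi.map_eq]
      rw [integral_map hi.measurable.aemeasurable hB.aestronglyMeasurable]
    have hk : (q k : ℝ) ≠ 0 := by exact_mod_cast (hq k).ne'
    rw [integral_const_mul, integral_finsetSum]
    · simp [hBi, hk]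
    · exact fun i _ => Integrable.mono' (integrable_const C)
        (hB.comp (f.continuous_extend.iterate i)).aestronglyMeasurable
        (ae_of_all _ fun z => hBC _)
  have hSint : ∀ (ν : Measure ℂ) [IsFiniteMeasure ν] k, Integrable (S k) ν := fun ν _ k =>
    Integrable.mono' (integrable_const C) (hS k).aestronglyMeasurable (ae_of_all _ (hSC k))
  have hdiff : ∀ x ∈ Disk, ∀ x' ∈ Disk, Tendsto (fun k => S k x' - S k x) atTop (𝓝 0) :=
    fun x hx x' hx' => by
      refine (f.tendsto_birkhoff_sub hA hq hconv
        (fun k z hz => norm_iterate_sub_le_d0 f (q k) hz) hx hx').congr fun k => ?_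
      have hs : ∀ z ∈ Disk, ∑ i ∈ Finset.range (q k), A (f.extend^[i] z) =
          ∑ i ∈ Finset.range (q k), B (f.extend^[i] z) := fun z hz =>
        Finset.sum_congr rfl fun i _ => (hBA _ (f.extend_iterate_mem i hz)).symm
      rw [hs x hx, hs x' hx', mul_sub]
  have hμS : ∀ k, ∫ z, S k z ∂μ = 0 := fun k => by
    rw [hint μ (f.measurePreserving_extend_of_invariant hμ), ← hμA]
    exact integral_congr_ae (hμD.mono hBA)
  have hpoint : ∀ x' ∈ Disk, Tendsto (fun k => S k x') atTop (𝓝 0) := fun x' hx' => by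
    have h : Tendsto (fun k => ∫ x, (S k x' - S k x) ∂μ) atTop (𝓝 (∫ _, (0 : ℝ) ∂μ)) := by
      refine tendsto_integral_of_dominated_convergence (fun _ => 2 * C)
        (fun k => (continuous_const.sub (hS k)).aestronglyMeasurable) (integrable_const _)
        (fun k => ae_of_all _ fun x => ?_) (hμD.mono fun x hx => hdiff x hx x' hx')
      linarith [norm_sub_le (S k x') (S k x), hSC k x, hSC k x']
    rw [integral_zero] at h
    refine h.congr fun k => ?_
    rw [integral_sub (integrable_const _) (hSint μ k), hμS]
    simp
  have hlim : Tendsto (fun k => ∫ z in Disk, S k z) atTop (𝓝 (∫ _ in Disk, (0 : ℝ))) :=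
    tendsto_integral_of_dominated_convergence (fun _ => C)
      (fun k => (hS k).aestronglyMeasurable) (integrable_const _)
      (fun k => ae_of_all _ (hSC k))
      ((ae_restrict_mem measurableSet_disk).mono hpoint)
  simp only [hint _ f.measurePreserving_extend, integral_zero] at hlim
  rw [← setIntegral_congr_fun measurableSet_disk hBA, tendsto_nhds_unique tendsto_const_nhds hlim,
    mul_zero]
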